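/- Let K be a number field with ring of integers O_K, β ∈ O_K with |N(β)| > 1, and (β) = 𝔭_1^{e_1}⋯𝔭_h^{e_h}. Suppose (β, {0,1,…,|N(β)|−1}) is a canonical number system in O_K and every 𝔭_j is unramified over ℚ. Then {0, 1, …, |N(β)|−1} is a complete set of representatives of O_K/βO_K, i.e., for distinct x, y ∈ {0,…,|N(β)|−1} one has x − y ∉ βO_K, and the map x ↦ x + βO_K is a bijection onto O_K/βO_K. -/

import Mathlib

open NumberField

theorem cns_unramified_gives_representatives
    (K : Type*) [Field K] [NumberField K] (β : 𝓞 K)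
    (hβ : 1 < |Algebra.norm ℤ β|)
    (hCNS : ∀ α : 𝓞 K, ∃ (m : ℕ) (a : ℕ → ℕ),
      (∀ j ≤ m, a j < (Algebra.norm ℤ β).natAbs) ∧
      α = ∑ j ∈ Finset.range (m + 1), (a j : 𝓞 K) * β ^ j)
    (hunram : ∀ P : Ideal (𝓞 K), P.IsPrime → P ≠ ⊥ → β ∈ P →
      ∀ q : ℕ, q.Prime → (q : 𝓞 K) ∈ P → (q : 𝓞 K) ∉ P ^ 2) :
    (∀ x y : ℕ, x < (Algebra.norm ℤ β).natAbs → y < (Algebra.norm ℤ β).natAbs →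
      x ≠ y → (x : 𝓞 K) - (y : 𝓞 K) ∉ Ideal.span {β}) ∧
    Function.Bijective
      (fun x : Fin (Algebra.norm ℤ β).natAbs =>
        Ideal.Quotient.mk (Ideal.span {β}) ((x : ℕ) : 𝓞 K)) := by
  set N := (Algebra.norm ℤ β).natAbs with hN
  set f : Fin N → 𝓞 K ⧸ Ideal.span {β} := fun x ↦ Ideal.Quotient.mk _ ((x : ℕ) : 𝓞 K) with hf
  have hcard : Nat.card (𝓞 K ⧸ Ideal.span {β}) = N := by
    rw [hN, ← Ideal.absNorm_span_singleton, Ideal.absNorm_apply, Submodule.cardQuot_apply]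
  have hsurj : Function.Surjective f := by
    intro y
    obtain ⟨α, rfl⟩ := Ideal.Quotient.mk_surjective y
    obtain ⟨m, a, ha, rfl⟩ := hCNS α
    refine ⟨⟨a 0, ha 0 m.zero_le⟩, ?_⟩
    have hβ0 : Ideal.Quotient.mk (Ideal.span {β}) β = 0 :=
      Ideal.Quotient.eq_zero_iff_mem.mpr (Ideal.mem_span_singleton_self β)
    simp [hf, Finset.sum_range_succ', hβ0]
  have hbij : Function.Bijective f :=
    hsurj.bijective_of_nat_card_le (by rw [hcard, Nat.card_fin])
  refine ⟨fun x y hx hy hxy hmem ↦ hxy ?_, hbij⟩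
  have hfxy : f ⟨x, hx⟩ = f ⟨y, hy⟩ := Ideal.Quotient.eq.mpr hmem
  exact congrArg Fin.val (hbij.injective hfxy)
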